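/- Let c > 0, v > 0 with v ≠ 1, ω ∈ {±1}, ε ∈ {±1}. For x = (x₁, x₀) ∈ ℝ² with x ≠ 0 define Ĩ_{ω,ε}(x) = ∫_{-1}^{1} (dp₁/(2πc)) ∫_{-∞}^{∞} (dp₀/(2π)) · (e^{-i(p₀x₀ + p₁x₁/c)} - 1)/((p₀ + iωp₁)(p₀ - iεωvp₁)). Then Ĩ_{ω,ε}(x) = (1/(2πc(1+εv))) [F(x₀, ωx₁/c) + ε F(vx₀, -εωx₁/c)], where F(x₀, x₁) = ∫₀¹ (dp₁/p₁)[exp(-p₁(|x₀| + i sgn(x₀) x₁)) - 1]. -/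

import Mathlib

open MeasureTheory Real

lemma aux_inv (g h : ℝ → ℂ) (hc : Continuous g) (hi : Integrable g) (hh : Integrable h)
    (H : ∀ p : ℝ, ∫ t : ℝ, Complex.exp (Complex.I * p * t) * g t = h p) (t : ℝ) :
    ∫ p : ℝ, Complex.exp (-Complex.I * p * t) * h p = 2 * π * g t := by
  have h1 : FourierTransformInv.fourierInv g = fun ξ : ℝ => h (2 * π * ξ) := by
    ext ξ
    rw [Real.fourierInv_eq', ← H]
    congr 1
    ext y
    simp only [smul_eq_mul]
    congr 2
    simp
    ring
  have hpi : (2 * π) ≠ 0 := by positivity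
  have h2 : FourierTransform.fourier (FourierTransformInv.fourierInv g) = g := by
    apply Continuous.fourier_fourierInv_eq hc hi
    have h3 : FourierTransformInv.fourierInv g = fun ξ : ℝ => h (2 * π * ξ) := h1
    have : Integrable (FourierTransformInv.fourierInv g) := by
      rw [h3]; exact hh.comp_mul_left' hpi
    first
      | exact this
      | (have := this.comp_neg
         convert this using 1
         ext x
         rw [Real.fourierInv_eq_fourier_neg]; simp)
  have h3 := congrFun h2 t
  rw [h1, Real.fourier_eq'] at h3
  rw [← h3]
  have := Measure.integral_comp_mul_left (fun p : ℝ => Complex.exp (-Complex.I * p * t) * h p) (2 * π)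
  rw [show (∫ v : ℝ, Complex.exp (((-2 * π * inner ℝ v t : ℝ) : ℂ) * Complex.I) • h (2 * π * v)) = ∫ x : ℝ, Complex.exp (-Complex.I * ((2 * π * x : ℝ) : ℂ) * t) * h (2 * π * x) from ?_, this]
  · rw [abs_of_pos (by positivity)]
    rw [Complex.real_smul]
    generalize (∫ p : ℝ, Complex.exp (-Complex.I * p * t) * h p) = X
    push_cast
    field_simp
  · congr 1
    ext y
    simp only [smul_eq_mul]
    congr 2
    simp
    ring

lemma aux_int (z w : ℝ) (hz : z ≠ 0) (hw : w ≠ 0) :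
    Integrable (fun p : ℝ => 1 / (((p : ℂ) + Complex.I * z) * ((p : ℂ) + Complex.I * w))) := by
  have hne : ∀ (z : ℝ), z ≠ 0 → ∀ p : ℝ, (p : ℂ) + Complex.I * z ≠ 0 := by
    intro z hz p h
    have := congrArg Complex.im h
    simp at this
    exact hz this
  have hn : ∀ (z : ℝ), ∀ p : ℝ, ‖(p : ℂ) + Complex.I * z‖ ^ 2 = p ^ 2 + z ^ 2 := by
    intro z p
    rw [← Complex.normSq_eq_norm_sq, Complex.normSq_apply]
    simp
    ring
  have hb : ∀ (z : ℝ), z ≠ 0 → ∀ p : ℝ, (‖(p : ℂ) + Complex.I * z‖⁻¹) ^ 2 ≤ (1 + 1 / z ^ 2) * (1 + p ^ 2)⁻¹ := by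
    intro z hz p
    rw [inv_pow, hn]
    have : 0 < z ^ 2 := by positivity
    rw [← div_eq_mul_inv, inv_eq_one_div, div_le_div_iff₀ (by positivity) (by positivity)]
    have : (1 + 1 / z ^ 2) * (p ^ 2 + z ^ 2) = p ^ 2 + z ^ 2 + p ^ 2 / z ^ 2 + 1 := by
      field_simp
      ring
    rw [this]
    have : 0 ≤ p ^ 2 / z ^ 2 := by positivity
    nlinarith
  apply Integrable.mono' (g := fun p : ℝ => ((1 + 1 / z ^ 2) + (1 + 1 / w ^ 2)) * (1 + p ^ 2)⁻¹)
  · exact integrable_inv_one_add_sq.const_mul _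
  · apply Continuous.aestronglyMeasurable
    apply Continuous.div (by fun_prop) (by fun_prop)
    intro p
    exact mul_ne_zero (hne z hz p) (hne w hw p)
  · filter_upwards with p
    rw [norm_div, norm_mul, norm_one, one_div, mul_inv, add_mul]
    nlinarith [hb z hz p, hb w hw p, sq_nonneg (‖(p : ℂ) + Complex.I * z‖⁻¹ - ‖(p : ℂ) + Complex.I * w‖⁻¹), sq_nonneg (‖(p : ℂ) + Complex.I * z‖⁻¹ + ‖(p : ℂ) + Complex.I * w‖⁻¹)]

lemma aux_E (ζ : ℂ) : IntervalIntegrable (fun p : ℝ => (Complex.exp (-(p : ℂ) * ζ) - 1) / (p : ℂ)) volume 0 1 := by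
  have hd : Differentiable ℝ (fun p : ℝ => Complex.exp (-(p : ℂ) * ζ)) := by
    intro x
    have h : DifferentiableAt ℝ (fun p : ℝ => (p : ℂ)) x := Complex.ofRealCLM.differentiableAt
    fun_prop
  have hcont : Continuous (dslope (fun p : ℝ => Complex.exp (-(p : ℂ) * ζ)) 0) := by
    rw [continuous_iff_continuousAt]
    intro x
    by_cases hx : x = 0
    · subst hx; exact continuousAt_dslope_same.2 (hd 0)
    · exact (continuousAt_dslope_of_ne hx).2 (hd x).continuousAt
  refine (hcont.intervalIntegrable 0 1).congr ?_
  intro p hp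
  rw [Set.uIoc_of_le zero_le_one] at hp
  have : p ≠ 0 := hp.1.ne'
  simp only [dslope_of_ne _ this, slope_def_module]
  simp
  field_simp

lemma aux_inv2 (A B h : ℝ → ℂ) (hA : Continuous A) (hB : Continuous B) (h0 : A 0 = B 0)
    (iA : IntegrableOn A (Set.Ioi 0)) (iB : IntegrableOn B (Set.Iic 0)) (hh : Integrable h)
    (H : ∀ p : ℝ, (∫ t : ℝ in Set.Iic 0, Complex.exp (Complex.I * p * t) * B t)
      + (∫ t : ℝ in Set.Ioi 0, Complex.exp (Complex.I * p * t) * A t) = h p) :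
    (∀ t : ℝ, 0 ≤ t → ∫ p : ℝ, Complex.exp (-Complex.I * p * t) * h p = 2 * π * A t) ∧
    (∀ t : ℝ, t ≤ 0 → ∫ p : ℝ, Complex.exp (-Complex.I * p * t) * h p = 2 * π * B t) := by
  set g : ℝ → ℂ := fun t => if t ≤ 0 then B t else A t with hg
  have gB : ∀ t : ℝ, t ≤ 0 → g t = B t := fun t ht => by simp [hg, ht]
  have gA : ∀ t : ℝ, 0 ≤ t → g t = A t := fun t ht => by
    rcases ht.eq_or_lt with h | h
    · subst h; simp [hg, h0]
    · simp [hg, not_le.2 h]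
  have hc : Continuous g := by
    apply Continuous.if_le hB hA continuous_id continuous_const
    rintro x rfl
    exact h0.symm
  have i1 : IntegrableOn g (Set.Ioi 0) := iA.congr_fun (fun t ht => (gA t (le_of_lt ht)).symm) measurableSet_Ioi
  have i2 : IntegrableOn g (Set.Iic 0) := iB.congr_fun (fun t ht => (gB t ht).symm) measurableSet_Iic
  have hi : Integrable g := by
    rw [← integrableOn_univ, ← Set.Iic_union_Ioi (a := (0 : ℝ))]
    exact i2.union i1
  have key := aux_inv g h hc hi hh ?_
  · exact ⟨fun t ht => by rw [key, gA t ht], fun t ht => by rw [key, gB t ht]⟩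
  · intro p
    have hi' : Integrable (fun t : ℝ => Complex.exp (Complex.I * p * t) * g t) := by
      refine hi.mono (Continuous.aestronglyMeasurable (by fun_prop)) ?_
      filter_upwards with t
      rw [norm_mul, Complex.norm_exp]
      simp
    rw [← H, ← intervalIntegral.integral_Iic_add_Ioi hi'.integrableOn hi'.integrableOn (b := 0)]
    congr 1
    · exact setIntegral_congr_fun measurableSet_Iic (fun t ht => by simp only [gB t ht])
    · exact setIntegral_congr_fun measurableSet_Ioi (fun t ht => by simp only [gA t (le_of_lt ht)])

lemma aux_ne (z : ℝ) (hz : z ≠ 0) (p : ℝ) : (p : ℂ) + Complex.I * z ≠ 0 := by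
  intro h
  have := congrArg Complex.im h
  simp at this
  exact hz this

lemma aux_Ioi (a p : ℝ) (ha : 0 < a) :
    ∫ t : ℝ in Set.Ioi 0, Complex.exp (Complex.I * p * t) * Complex.exp (-a * t) =
      Complex.I / (p + Complex.I * a) := by
  have := integral_exp_mul_complex_Ioi (a := Complex.I * p - a) (by simpa using ha) 0
  simp_rw [← Complex.exp_add]
  rw [show (fun t : ℝ => Complex.exp (Complex.I * p * t + -a * t)) = fun t : ℝ => Complex.exp ((Complex.I * p - a) * t) from ?_, this]
  · have h1 := aux_ne a ha.ne' p
    have h2 : Complex.I * p - a ≠ 0 := by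
      intro h; apply h1
      linear_combination (-Complex.I) * h + p * Complex.I_sq
    rw [div_eq_div_iff h2 h1]
    simp
    linear_combination p * Complex.I_sq * (-1)
  · ext t; congr 1; ring

lemma aux_Iic (b p : ℝ) (hb : 0 < b) :
    ∫ t : ℝ in Set.Iic 0, Complex.exp (Complex.I * p * t) * Complex.exp (b * t) =
      -Complex.I / (p - Complex.I * b) := by
  have := integral_exp_mul_complex_Iic (a := Complex.I * p + b) (by simpa using hb) 0
  simp_rw [← Complex.exp_add]
  rw [show (fun t : ℝ => Complex.exp (Complex.I * p * t + b * t)) = fun t : ℝ => Complex.exp ((Complex.I * p + b) * t) from ?_, this]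
  · have h1 : (p : ℂ) - Complex.I * b ≠ 0 := by
      have := aux_ne (-b) (by simpa using hb.ne') p
      simpa [sub_eq_add_neg] using this
    have h2 : Complex.I * p + b ≠ 0 := by
      intro h; apply h1
      linear_combination (-Complex.I) * h + p * Complex.I_sq
    rw [div_eq_div_iff h2 h1]
    simp
    linear_combination p * Complex.I_sq
  · ext t; congr 1; ring

lemma aux_K1 (a b : ℝ) (ha : 0 < a) (hb : 0 < b) (t : ℝ) (ht : 0 ≤ t) :
    ∫ p : ℝ, Complex.exp (-Complex.I * p * t) * (1 / (((p : ℂ) + Complex.I * a) * ((p : ℂ) - Complex.I * b)))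
      = 2 * π * (Complex.exp (-a * t) / (a + b)) := by
  have hab : (a : ℂ) + b ≠ 0 := by
    have : a + b ≠ 0 := by positivity
    exact_mod_cast this
  refine (aux_inv2 (fun t => Complex.exp (-a * t) / (a + b)) (fun t => Complex.exp (b * t) / (a + b))
    (fun p : ℝ => 1 / (((p : ℂ) + Complex.I * a) * ((p : ℂ) - Complex.I * b)))
    (by fun_prop) (by fun_prop) (by simp) ?_ ?_ ?_ ?_).1 t ht
  · exact (integrableOn_exp_mul_complex_Ioi (a := -a) (by simpa using ha) 0).div_const _
  · exact (integrableOn_exp_mul_complex_Iic (a := b) (by simpa using hb) 0).div_const _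
  · simpa [sub_eq_add_neg] using aux_int a (-b) ha.ne' (by simpa using hb.ne')
  · intro p
    simp_rw [← mul_div_assoc]
    rw [integral_div, integral_div, aux_Ioi a p ha, aux_Iic b p hb]
    have h1 : (p : ℂ) - Complex.I * b ≠ 0 := by
      have := aux_ne (-b) (by simpa using hb.ne') p
      simpa [sub_eq_add_neg] using this
    have h2 := aux_ne a ha.ne' p
    field_simp
    linear_combination (-(a : ℂ) - b) * Complex.I_sq

lemma aux_K2 (a b : ℝ) (ha : 0 < a) (hb : 0 < b) (hne : a ≠ b) :
    (∀ t : ℝ, 0 ≤ t → ∫ p : ℝ, Complex.exp (-Complex.I * p * t) * (1 / (((p : ℂ) + Complex.I * a) * ((p : ℂ) + Complex.I * b)))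
      = 2 * π * ((Complex.exp (-a * t) - Complex.exp (-b * t)) / (a - b))) ∧
    (∀ t : ℝ, t ≤ 0 → ∫ p : ℝ, Complex.exp (-Complex.I * p * t) * (1 / (((p : ℂ) + Complex.I * a) * ((p : ℂ) + Complex.I * b)))
      = 2 * π * 0) := by
  have hab : (a : ℂ) - b ≠ 0 := by
    have : a - b ≠ 0 := sub_ne_zero.2 hne
    exact_mod_cast this
  have I1 := (integrableOn_exp_mul_complex_Ioi (a := -a) (by simpa using ha) 0)
  have I2 := (integrableOn_exp_mul_complex_Ioi (a := -b) (by simpa using hb) 0)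
  have I3 : ∀ a p : ℝ, 0 < a → IntegrableOn (fun t : ℝ => Complex.exp (Complex.I * p * t) * Complex.exp (-a * t)) (Set.Ioi 0) := by
    intro a p ha
    refine (integrableOn_exp_mul_complex_Ioi (a := Complex.I * p - a) (by simpa using ha) 0).congr_fun ?_ measurableSet_Ioi
    intro t _
    simp only []
    rw [← Complex.exp_add]; congr 1; ring
  refine (aux_inv2 (fun t => (Complex.exp (-a * t) - Complex.exp (-b * t)) / (a - b)) (fun t => 0)
    (fun p : ℝ => 1 / (((p : ℂ) + Complex.I * a) * ((p : ℂ) + Complex.I * b)))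
    (by fun_prop) (by fun_prop) (by simp) ?_ ?_ ?_ ?_)
  · exact (I1.sub I2).div_const _
  · exact integrableOn_zero
  · exact aux_int a b ha.ne' hb.ne'
  · intro p
    simp_rw [← mul_div_assoc, mul_sub]
    rw [integral_div, integral_sub (I3 a p ha) (I3 b p hb), aux_Ioi a p ha, aux_Ioi b p hb]
    have h1 := aux_ne b hb.ne' p
    have h2 := aux_ne a ha.ne' p
    simp
    field_simp
    linear_combination (-(a : ℂ) + b) * Complex.I_sq

/-- the inner integral in terms of the two Fourier integrals -/
lemma aux_J (z w t θ : ℝ) (hz : z ≠ 0) (hw : w ≠ 0) :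
    ∫ p : ℝ, (Complex.exp (-Complex.I * (p * t + θ)) - 1) / (((p : ℂ) + Complex.I * z) * ((p : ℂ) + Complex.I * w))
    = Complex.exp (-Complex.I * θ) * (∫ p : ℝ, Complex.exp (-Complex.I * p * t) * (1 / (((p : ℂ) + Complex.I * z) * ((p : ℂ) + Complex.I * w))))
     - ∫ p : ℝ, Complex.exp (-Complex.I * p * (0 : ℝ)) * (1 / (((p : ℂ) + Complex.I * z) * ((p : ℂ) + Complex.I * w))) := by
  have hi : ∀ t : ℝ, Integrable (fun p : ℝ => Complex.exp (-Complex.I * p * t) * (1 / (((p : ℂ) + Complex.I * z) * ((p : ℂ) + Complex.I * w)))) := by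
    intro t
    have := aux_int z w hz hw
    refine this.mono (AEStronglyMeasurable.mul (Continuous.aestronglyMeasurable (by fun_prop)) this.1) ?_
    filter_upwards with p
    rw [norm_mul, Complex.norm_exp]
    simp
  rw [← integral_const_mul, ← integral_sub ((hi t).const_mul _) (hi 0)]
  congr 1
  ext p
  rw [← mul_assoc, ← Complex.exp_add, show -Complex.I * θ + -Complex.I * p * t = -Complex.I * (p * t + θ) by ring]
  rw [sub_div, div_eq_mul_one_div (Complex.exp _)]
  simp

/-- ε = 1, q > 0 -/
lemma aux_J1 (v t s q : ℝ) (hv : 0 < v) (ht : 0 < t) (hq : 0 < q) :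
    ∫ p : ℝ, (Complex.exp (-Complex.I * (p * t + q * s)) - 1) / (((p : ℂ) + Complex.I * q) * ((p : ℂ) - Complex.I * v * q))
    = 2 * π / (1 + v) * ((Complex.exp (-(q : ℂ) * (t + Complex.I * s)) - 1) / q) := by
  have hvq : 0 < v * q := by positivity
  have h := aux_J q (-(v * q)) t (q * s) hq.ne' (by simpa using hvq.ne')
  have k1 := aux_K1 q (v * q) hq hvq t ht.le
  have k2 := aux_K1 q (v * q) hq hvq 0 le_rfl
  push_cast at h k1 k2
  simp only [mul_neg, ← sub_eq_add_neg, ← mul_assoc] at h k1 k2 ⊢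
  rw [h, k1, k2, show Complex.exp (-(q : ℂ) * (t + Complex.I * s)) = Complex.exp (-Complex.I * q * s) * Complex.exp (-q * t) by rw [← Complex.exp_add]; congr 1; ring]
  have hq' : (q : ℂ) ≠ 0 := by exact_mod_cast hq.ne'
  have h1 : (1 : ℂ) + v ≠ 0 := by
    have : 1 + v ≠ 0 := by positivity
    exact_mod_cast this
  have h2 : (q : ℂ) + v * q = (1 + v) * q := by ring
  rw [h2]
  simp
  field_simp

/-- ε = 1, q < 0 -/
lemma aux_J2 (v t s q : ℝ) (hv : 0 < v) (ht : 0 < t) (hq : 0 < q) :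
    ∫ p : ℝ, (Complex.exp (-Complex.I * (p * t + (-q : ℝ) * s)) - 1) / (((p : ℂ) + Complex.I * (-q : ℝ)) * ((p : ℂ) - Complex.I * v * (-q : ℝ)))
    = 2 * π / (1 + v) * ((Complex.exp (-(q : ℂ) * (v * t - Complex.I * s)) - 1) / q) := by
  have hvq : 0 < v * q := by positivity
  have h := aux_J (v * q) (-q) t (-q * s) hvq.ne' (by simpa using hq.ne')
  have k1 := aux_K1 (v * q) q hvq hq t ht.le
  have k2 := aux_K1 (v * q) q hvq hq 0 le_rfl
  have e : ∀ p : ℝ, (((p : ℂ) + Complex.I * (-q : ℝ)) * ((p : ℂ) - Complex.I * v * (-q : ℝ))) = ((p : ℂ) + Complex.I * v * q) * (p - Complex.I * q) := by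
    intro p; push_cast; ring
  simp_rw [e]
  push_cast at h k1 k2 ⊢
  simp only [mul_neg, ← sub_eq_add_neg, ← mul_assoc] at h k1 k2 ⊢
  rw [h, k1, k2, show Complex.exp (-(q : ℂ) * (v * t - Complex.I * s)) = Complex.exp (-Complex.I * -q * s) * Complex.exp (-(v * q) * t) by rw [← Complex.exp_add]; congr 1; ring]
  have hq' : (q : ℂ) ≠ 0 := by exact_mod_cast hq.ne'
  have h1 : (1 : ℂ) + v ≠ 0 := by
    have : 1 + v ≠ 0 := by positivity
    exact_mod_cast this
  have h2 : v * (q : ℂ) + q = (1 + v) * q := by ring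
  rw [h2]
  simp
  field_simp

/-- ε = -1, q > 0 -/
lemma aux_J3 (v t s q : ℝ) (hv : 0 < v) (hv1 : v ≠ 1) (ht : 0 < t) (hq : 0 < q) :
    ∫ p : ℝ, (Complex.exp (-Complex.I * (p * t + q * s)) - 1) / (((p : ℂ) + Complex.I * q) * ((p : ℂ) + Complex.I * v * q))
    = 2 * π / (1 - v) * ((Complex.exp (-(q : ℂ) * (t + Complex.I * s)) - 1) / q
      - (Complex.exp (-(q : ℂ) * (v * t + Complex.I * s)) - 1) / q) := by
  have hvq : 0 < v * q := by positivity
  have hne : q ≠ v * q := by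
    intro h
    apply hv1
    have : (v - 1) * q = 0 := by linarith
    rcases mul_eq_zero.1 this with h | h <;> linarith
  have h := aux_J q (v * q) t (q * s) hq.ne' hvq.ne'
  have k1 := (aux_K2 q (v * q) hq hvq hne).1 t ht.le
  have k2 := (aux_K2 q (v * q) hq hvq hne).1 0 le_rfl
  push_cast at h k1 k2
  simp only [← mul_assoc] at h k1 k2 ⊢
  rw [h, k1, k2, show Complex.exp (-(q : ℂ) * (t + Complex.I * s)) = Complex.exp (-Complex.I * q * s) * Complex.exp (-q * t) by rw [← Complex.exp_add]; congr 1; ring,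
    show Complex.exp (-(q : ℂ) * (v * t + Complex.I * s)) = Complex.exp (-Complex.I * q * s) * Complex.exp (-(v * q) * t) by rw [← Complex.exp_add]; congr 1; ring]
  have hq' : (q : ℂ) ≠ 0 := by exact_mod_cast hq.ne'
  have h1 : (1 : ℂ) - v ≠ 0 := by
    have : 1 - v ≠ 0 := sub_ne_zero.2 hv1.symm
    exact_mod_cast this
  have h2 : (q : ℂ) - v * q = (1 - v) * q := by ring
  rw [h2]
  simp
  field_simp
  ring

/-- ε = -1, q < 0 -/
lemma aux_J4 (v t s q : ℝ) (hv : 0 < v) (hv1 : v ≠ 1) (ht : 0 < t) (hq : 0 < q) :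
    ∫ p : ℝ, (Complex.exp (-Complex.I * (p * t + (-q : ℝ) * s)) - 1) / (((p : ℂ) + Complex.I * (-q : ℝ)) * ((p : ℂ) + Complex.I * v * (-q : ℝ)))
    = 0 := by
  have hvq : 0 < v * q := by positivity
  have hne : q ≠ v * q := by
    intro h
    apply hv1
    have : (v - 1) * q = 0 := by linarith
    rcases mul_eq_zero.1 this with h | h <;> linarith
  have h := aux_J q (v * q) (-t) (-q * s) hq.ne' hvq.ne'
  have k1 := (aux_K2 q (v * q) hq hvq hne).2 (-t) (by linarith)
  have k2 := (aux_K2 q (v * q) hq hvq hne).2 0 le_rfl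
  rw [k1, k2] at h
  rw [← integral_neg_eq_self]
  simp only [mul_zero, sub_zero] at h
  rw [← h]
  congr 1
  ext p
  push_cast
  congr 1
  · congr 2
    ring
  · ring

lemma aux_split (J A B : ℝ → ℂ) (iA : IntervalIntegrable A volume 0 1) (iB : IntervalIntegrable B volume 0 1)
    (hA : ∀ q : ℝ, 0 < q → J q = A q) (hB : ∀ q : ℝ, 0 < q → J (-q) = B q) :
    ∫ q in Set.Ioc (-1 : ℝ) 1, J q = (∫ q in Set.Ioc (0 : ℝ) 1, A q) + ∫ q in Set.Ioc (0 : ℝ) 1, B q := by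
  have i1 : IntervalIntegrable J volume 0 1 := by
    refine iA.congr ?_
    intro q hq
    rw [Set.uIoc_of_le zero_le_one] at hq
    exact (hA q hq.1).symm
  have i2' : IntervalIntegrable (fun q => J (-q)) volume 0 1 := by
    refine iB.congr ?_
    intro q hq
    rw [Set.uIoc_of_le zero_le_one] at hq
    exact (hB q hq.1).symm
  have i2 : IntervalIntegrable J volume (-1) 0 := by
    have := ((IntervalIntegrable.iff_comp_neg (by simp)).1 i2').symm
    simpa using this
  rw [← intervalIntegral.integral_of_le (by norm_num), ← intervalIntegral.integral_add_adjacent_intervals i2 i1, add_comm]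
  congr 1
  · rw [intervalIntegral.integral_of_le zero_le_one]
    exact setIntegral_congr_fun measurableSet_Ioc (fun q hq => hA q hq.1)
  · have := intervalIntegral.integral_comp_neg (a := 0) (b := 1) J
    rw [neg_zero] at this
    rw [← this, intervalIntegral.integral_of_le zero_le_one]
    exact setIntegral_congr_fun measurableSet_Ioc (fun q hq => hB q hq.1)

lemma aux_core (v t s ε : ℝ) (hv : 0 < v) (hv1 : v ≠ 1) (ht : 0 < t) (hε : ε = 1 ∨ ε = -1) :
    ∫ q in Set.Ioc (-1 : ℝ) 1, ∫ p : ℝ, (Complex.exp (-Complex.I * (p * t + q * s)) - 1) / (((p : ℂ) + Complex.I * q) * ((p : ℂ) - Complex.I * ε * v * q))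
    = 2 * π / (1 + ε * v) * ((∫ q in Set.Ioc (0 : ℝ) 1, (Complex.exp (-(q : ℂ) * (t + Complex.I * s)) - 1) / (q : ℂ))
      + ε * ∫ q in Set.Ioc (0 : ℝ) 1, (Complex.exp (-(q : ℂ) * (v * t - Complex.I * ε * s)) - 1) / (q : ℂ)) := by
  rcases hε with rfl | rfl
  · rw [aux_split _ _ _ ((aux_E (t + Complex.I * s)).const_mul (2 * π / (1 + v)))
      ((aux_E (v * t - Complex.I * s)).const_mul (2 * π / (1 + v)))]
    · rw [integral_const_mul, integral_const_mul]
      simp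
      ring
    · intro q hq
      rw [← aux_J1 v t s q hv ht hq]
      simp
    · intro q hq
      rw [← aux_J2 v t s q hv ht hq]
      simp
  · have E1 := aux_E (t + Complex.I * s)
    have E2 := aux_E (v * t + Complex.I * s)
    rw [aux_split _ _ (fun _ => 0) ((E1.sub E2).const_mul (2 * π / (1 - v))) (by simp)]
    · rw [integral_const_mul]
      rw [intervalIntegrable_iff_integrableOn_Ioc_of_le zero_le_one] at E1 E2
      rw [integral_sub E1 E2]
      simp [sub_eq_add_neg]
    · intro q hq
      rw [← aux_J3 v t s q hv hv1 ht hq]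
      simp
    · intro q hq
      rw [← aux_J4 v t s q hv hv1 ht hq]
      simp [sub_eq_add_neg]

/-- both signs of t -/
lemma aux_core2 (v t s ε : ℝ) (hv : 0 < v) (hv1 : v ≠ 1) (ht : t ≠ 0) (hε : ε = 1 ∨ ε = -1)
    (F : ℝ → ℝ → ℂ)
    (hF : ∀ x₀ x₁ : ℝ, F x₀ x₁ =
      ∫ p in Set.Ioc (0 : ℝ) 1,
        (Complex.exp (-(p : ℂ) * ((|x₀| : ℝ) + Complex.I * (Real.sign x₀ : ℝ) * (x₁ : ℝ))) - 1)
          / (p : ℂ)) :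
    ∫ q in Set.Ioc (-1 : ℝ) 1, ∫ p : ℝ, (Complex.exp (-Complex.I * (p * t + q * s)) - 1) / (((p : ℂ) + Complex.I * q) * ((p : ℂ) - Complex.I * ε * v * q))
    = 2 * π / (1 + ε * v) * (F t s + ε * F (v * t) (-ε * s)) := by
  have pos : ∀ t s : ℝ, 0 < t → ∫ q in Set.Ioc (-1 : ℝ) 1, ∫ p : ℝ, (Complex.exp (-Complex.I * (p * t + q * s)) - 1) / (((p : ℂ) + Complex.I * q) * ((p : ℂ) - Complex.I * ε * v * q))
    = 2 * π / (1 + ε * v) * (F t s + ε * F (v * t) (-ε * s)) := by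
    intro t s ht
    have hvt : 0 < v * t := by positivity
    rw [aux_core v t s ε hv hv1 ht hε, hF, hF, Real.sign_of_pos ht, Real.sign_of_pos hvt, abs_of_pos ht, abs_of_pos hvt]
    simp [sub_eq_add_neg, mul_assoc]
  rcases lt_or_gt_of_ne ht with h | h
  · have hFn : ∀ a b : ℝ, F (-a) (-b) = F a b := by
      intro a b
      rw [hF, hF, abs_neg, Real.sign_neg]
      simp
    have := pos (-t) (-s) (by linarith)
    rw [hFn, mul_neg, mul_neg, hFn] at this
    rw [← this, ← intervalIntegral.integral_of_le (by norm_num), ← intervalIntegral.integral_of_le (by norm_num)]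
    conv_lhs => rw [← neg_neg (1 : ℝ), ← intervalIntegral.integral_comp_neg, neg_neg]
    congr 1
    ext q
    rw [← integral_neg_eq_self]
    congr 1
    ext p
    push_cast
    congr 1
    · congr 2
      ring
    · ring
  · exact pos t s h

open MeasureTheory Real

/-- Evaluation of
`Ĩ_{ω,ε}(x) = ∫_{-1}^{1} (dp₁/(2πc)) ∫_ℝ (dp₀/(2π)) (e^{-i(p₀x₀+p₁x₁/c)} - 1)
/((p₀+iωp₁)(p₀-iεωvp₁))`:
for `x₀ ≠ 0`,
`Ĩ_{ω,ε}(x) = (1/(2πc(1+εv))) [F(x₀, ωx₁/c) + ε F(vx₀, -εωx₁/c)]`, with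
`F(x₀,x₁) = ∫₀¹ (dp/p)[exp(-p(|x₀| + i sgn(x₀) x₁)) - 1]`. -/
theorem stmt_17 (c v : ℝ) (hc : 0 < c) (hv : 0 < v) (hv1 : v ≠ 1)
    (ω ε : ℝ) (hω : ω = 1 ∨ ω = -1) (hε : ε = 1 ∨ ε = -1)
    (F : ℝ → ℝ → ℂ)
    (hF : ∀ x₀ x₁ : ℝ, F x₀ x₁ =
      ∫ p in Set.Ioc (0 : ℝ) 1,
        (Complex.exp (-(p : ℂ) * ((|x₀| : ℝ) + Complex.I * (Real.sign x₀ : ℝ) * (x₁ : ℝ))) - 1)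
          / (p : ℂ))
    (Itld : ℝ × ℝ → ℂ)
    (hI : ∀ x : ℝ × ℝ, Itld x =
      (1 / (2 * π * c)) * ∫ p₁ in Set.Ioc (-1 : ℝ) 1,
        (1 / (2 * π)) * ∫ p₀ : ℝ,
          (Complex.exp (-Complex.I * ((p₀ : ℂ) * (x.2 : ℂ) + (p₁ : ℂ) * (x.1 : ℂ) / (c : ℂ))) - 1)
            / (((p₀ : ℂ) + Complex.I * (ω : ℂ) * (p₁ : ℂ)) *
               ((p₀ : ℂ) - Complex.I * (ε : ℂ) * (ω : ℂ) * (v : ℂ) * (p₁ : ℂ)))) :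
    ∀ x : ℝ × ℝ, x ≠ 0 → x.2 ≠ 0 →
      Itld x = (1 / (2 * π * c * (1 + ε * v)) : ℝ) *
        (F x.2 (ω * x.1 / c) + (ε : ℂ) * F (v * x.2) (-ε * ω * x.1 / c)) := by
  intro x _ hx
  have hk := aux_core2 v x.2 (ω * x.1 / c) ε hv hv1 hx hε F hF
  rw [hI, integral_const_mul]
  have key : (∫ p₁ in Set.Ioc (-1 : ℝ) 1, ∫ p₀ : ℝ,
          (Complex.exp (-Complex.I * ((p₀ : ℂ) * (x.2 : ℂ) + (p₁ : ℂ) * (x.1 : ℂ) / (c : ℂ))) - 1)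
            / (((p₀ : ℂ) + Complex.I * (ω : ℂ) * (p₁ : ℂ)) *
               ((p₀ : ℂ) - Complex.I * (ε : ℂ) * (ω : ℂ) * (v : ℂ) * (p₁ : ℂ))))
      = 2 * π / (1 + ε * v) * (F x.2 (ω * x.1 / c) + ε * F (v * x.2) (-ε * (ω * x.1 / c))) := by
    rw [← hk]
    rcases hω with rfl | rfl
    · congr 1
      ext q
      congr 1
      ext p
      push_cast
      congr 1
      · congr 2
        ring
      · ring
    · rw [← intervalIntegral.integral_of_le (by norm_num), ← intervalIntegral.integral_of_le (by norm_num)]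
      conv_lhs => rw [← neg_neg (1 : ℝ), ← intervalIntegral.integral_comp_neg, neg_neg]
      congr 1
      ext q
      congr 1
      ext p
      push_cast
      congr 1
      · congr 2
        ring
      · ring
      norm_num
  rw [key, show -ε * (ω * x.1 / c) = -ε * ω * x.1 / c by ring]
  have h1 : (1 : ℂ) + ε * v ≠ 0 := by
    have : 1 + ε * v ≠ 0 := by
      rcases hε with rfl | rfl
      · positivity
      · intro h; apply hv1; linarith
    exact_mod_cast this
  have hc' : (c : ℂ) ≠ 0 := by exact_mod_cast hc.ne'
  have hpi : (π : ℂ) ≠ 0 := by exact_mod_cast Real.pi_ne_zero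
  push_cast
  field_simp
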